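/- There exists an absolute constant C > 0 such that for every integer N ≥ 2, | N/π(N) − log N | ≤ 6C; equivalently, the sequence (N/π(N) − log N)_{N ≥ 2} is bounded, where π(N) is the number of primes not exceeding N. -/

import Mathlib

open Filter

namespace PNTaux
open Complex Topology

/-- Euler Maclaurin terms, multiplied by `s - 1`. -/
noncomputable def T (n : ℕ) (s : ℂ) : ℂ :=
  (s - 1) * ((n : ℂ) + 1) ^ (-s) + ((n : ℂ) + 1) ^ (1 - s) - (n : ℂ) ^ (1 - s)

lemma differentiable_T (n : ℕ) (hn : 1 ≤ n) : Differentiable ℂ (T n) := by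
  have h1 : ((n : ℂ) + 1) ≠ 0 := by exact_mod_cast Nat.succ_ne_zero n
  have h2 : (n : ℂ) ≠ 0 := by exact_mod_cast (by lia : n ≠ 0)
  intro s
  unfold T
  have a1 : DifferentiableAt ℂ (fun s : ℂ => ((n : ℂ) + 1) ^ (-s)) s :=
    DifferentiableAt.const_cpow (by fun_prop) (Or.inl h1)
  have a2 : DifferentiableAt ℂ (fun s : ℂ => ((n : ℂ) + 1) ^ (1 - s)) s :=
    DifferentiableAt.const_cpow (by fun_prop) (Or.inl h1)
  have a3 : DifferentiableAt ℂ (fun s : ℂ => (n : ℂ) ^ (1 - s)) s :=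
    DifferentiableAt.const_cpow (by fun_prop) (Or.inl h2)
  fun_prop

lemma hasDerivAt_cpow' (r : ℂ) {u : ℝ} (hu : 0 < u) :
    HasDerivAt (fun u : ℝ => (u : ℂ) ^ r) (r * (u : ℂ) ^ (r - 1)) u := by
  by_cases hr : r = 0
  · subst hr; simpa using hasDerivAt_const u (1 : ℂ)
  exact hasDerivAt_ofReal_cpow_const hu.ne' hr

lemma norm_T_le (n : ℕ) (hn : 1 ≤ n) (s : ℂ) (hs : 0 < s.re) :
    ‖T n s‖ ≤ ‖s - 1‖ * ‖s‖ * (n : ℝ) ^ (-s.re - 1) := by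
  have hn0 : (0 : ℝ) < n := by exact_mod_cast hn
  have key : ∀ u ∈ Set.Icc (n : ℝ) (n + 1),
      ‖((n : ℂ) + 1) ^ (-s) - (u : ℂ) ^ (-s)‖ ≤ ‖s‖ * (n : ℝ) ^ (-s.re - 1) := by
    intro u hu
    have := (convex_Icc (n : ℝ) (n + 1)).norm_image_sub_le_of_norm_hasDerivWithin_le
      (f := fun u : ℝ => (u : ℂ) ^ (-s)) (f' := fun u : ℝ => (-s) * (u : ℂ) ^ (-s - 1))
      (C := ‖s‖ * (n : ℝ) ^ (-s.re - 1)) (x := u) (y := n + 1)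
      (fun v hv => (hasDerivAt_cpow' (-s) (hn0.trans_le hv.1)).hasDerivWithinAt)
      (fun v hv => by
        rw [norm_mul, norm_neg, norm_cpow_eq_rpow_re_of_pos (hn0.trans_le hv.1)]
        gcongr
        simp only [sub_re, neg_re, one_re]
        exact Real.rpow_le_rpow_of_nonpos hn0 hv.1 (by linarith)) hu
      (by constructor <;> simp)
    simp only [ofReal_add, ofReal_natCast, ofReal_one] at this
    refine this.trans ?_
    have h1 : ‖(n : ℝ) + 1 - u‖ ≤ 1 := by
      rw [Real.norm_eq_abs, abs_le]; constructor <;> linarith [hu.1, hu.2]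
    exact mul_le_of_le_one_right (by positivity) h1
  have := (convex_Icc (n : ℝ) (n + 1)).norm_image_sub_le_of_norm_hasDerivWithin_le
      (f := fun u : ℝ => (s - 1) * ((n : ℂ) + 1) ^ (-s) * u + (u : ℂ) ^ (1 - s))
      (f' := fun u : ℝ => (s - 1) * ((n : ℂ) + 1) ^ (-s) * 1 + (1 - s) * (u : ℂ) ^ (1 - s - 1))
      (C := ‖s - 1‖ * ‖s‖ * (n : ℝ) ^ (-s.re - 1)) (x := n) (y := n + 1)
      (fun v hv => (((hasDerivAt_id v).ofReal_comp.const_mul _).add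
        (hasDerivAt_cpow' (1 - s) (hn0.trans_le hv.1))).hasDerivWithinAt)
      (fun v hv => by
        have h := key v hv
        have e : (s - 1) * ((n : ℂ) + 1) ^ (-s) * 1 + (1 - s) * (v : ℂ) ^ (1 - s - 1)
          = (s - 1) * (((n : ℂ) + 1) ^ (-s) - (v : ℂ) ^ (-s)) := by
          rw [show 1 - s - 1 = -s by ring]; ring
        rw [e, norm_mul, mul_assoc]
        gcongr) (by constructor <;> simp)
      (by constructor <;> simp)
  simp only [ofReal_add, ofReal_natCast, ofReal_one, add_sub_cancel_left, norm_one, mul_one] at this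
  refine le_trans (le_of_eq ?_) this
  congr 1
  unfold T
  ring

lemma summable_shift (p : ℝ) (hp : 1 < p) (N : ℕ) :
    Summable (fun n : ℕ => ((n + N : ℕ) : ℝ) ^ (-p)) :=
  (summable_nat_add_iff N).mpr (Real.summable_nat_rpow.mpr (by linarith))

lemma summable_T (N : ℕ) (hN : 1 ≤ N) (s : ℂ) (hs : 0 < s.re) :
    Summable (fun n => T (n + N) s) := by
  refine Summable.of_norm_bounded (g := fun n : ℕ => ‖s - 1‖ * ‖s‖ * ((n + N : ℕ) : ℝ) ^ (-s.re - 1))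
    ?_ (fun n => norm_T_le _ (by lia) s hs)
  refine Summable.mul_left _ ?_
  have := summable_shift (s.re + 1) (by linarith) N
  simpa [sub_eq_add_neg, add_comm] using this

lemma partial_T (N : ℕ) (s : ℂ) (M : ℕ) :
    ∑ n ∈ Finset.range M, T (n + N) s =
      (s - 1) * (∑ n ∈ Finset.range (M + N), ((n : ℂ) + 1) ^ (-s)
        - ∑ n ∈ Finset.range N, ((n : ℂ) + 1) ^ (-s))
        + ((M + N : ℕ) : ℂ) ^ (1 - s) - (N : ℂ) ^ (1 - s) := by
  induction M with
  | zero => simp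
  | succ M ih =>
    rw [Finset.sum_range_succ, ih, show M + 1 + N = (M + N) + 1 by ring, Finset.sum_range_succ]
    unfold T
    push_cast
    ring

lemma zeta_formula_one_lt (N : ℕ) (hN : 1 ≤ N) (s : ℂ) (hs : 1 < s.re) :
    (s - 1) * riemannZeta s = (s - 1) * ∑ n ∈ Finset.range N, ((n : ℂ) + 1) ^ (-s)
      + (N : ℂ) ^ (1 - s) + ∑' n, T (n + N) s := by
  have h1 := (summable_T N hN s (by linarith)).hasSum.tendsto_sum_nat
  have hz : Summable (fun n : ℕ => 1 / ((n : ℂ) + 1) ^ s) := by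
    have := (summable_nat_add_iff 1).mpr (Complex.summable_one_div_nat_cpow.mpr hs)
    simpa using this
  have h2 := hz.hasSum.tendsto_sum_nat
  rw [← zeta_eq_tsum_one_div_nat_add_one_cpow hs] at h2
  have h2' : Tendsto (fun M => ∑ n ∈ Finset.range (M + N), ((n : ℂ) + 1) ^ (-s)) atTop
      (𝓝 (riemannZeta s)) := by
    have := (tendsto_add_atTop_iff_nat N).mpr h2
    simpa [cpow_neg] using this
  have h3 : Tendsto (fun M : ℕ => ((M + N : ℕ) : ℂ) ^ (1 - s)) atTop (𝓝 0) := by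
    rw [tendsto_zero_iff_norm_tendsto_zero]
    have : Tendsto (fun M : ℕ => (M : ℝ) ^ (-(s.re - 1))) atTop (𝓝 0) :=
      (tendsto_rpow_neg_atTop (by linarith)).comp tendsto_natCast_atTop_atTop
    have := (tendsto_add_atTop_iff_nat N).mpr this
    refine this.congr fun M => ?_
    rw [norm_natCast_cpow_of_pos (by lia)]
    simp
  have h4 := ((((h2'.sub_const (∑ n ∈ Finset.range N, ((n : ℂ) + 1) ^ (-s))).const_mul (s - 1)).add
    h3).sub_const ((N : ℂ) ^ (1 - s)))
  simp_rw [partial_T] at h1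
  have := tendsto_nhds_unique h1 h4
  rw [this]; ring

lemma zeta_formula (N : ℕ) (hN : 1 ≤ N) (s : ℂ) (hs : 1 / 2 < s.re) :
    riemannZeta₁ s = (s - 1) * ∑ n ∈ Finset.range N, ((n : ℂ) + 1) ^ (-s)
      + (N : ℂ) ^ (1 - s) + ∑' n, T (n + N) s := by
  set R : ℝ := ‖s‖ + 4
  set U : Set ℂ := {z | 1 / 2 < z.re} ∩ Metric.ball 0 R
  have hUo : IsOpen U := (isOpen_lt continuous_const continuous_re).inter Metric.isOpen_ball
  have hUc : Convex ℝ U := (convex_halfSpace_re_gt _).inter (convex_ball _ _)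
  have hR : 4 ≤ R := by simp [R]
  have h2U : (2 : ℂ) ∈ U := by
    refine ⟨by simp; norm_num, ?_⟩
    simp only [Metric.mem_ball, dist_zero_right, Complex.norm_ofNat]; linarith
  have hsU : s ∈ U := ⟨hs, by simp [R]⟩
  have hf : DifferentiableOn ℂ riemannZeta₁ U := differentiable_riemannZeta₁.differentiableOn
  have hT : DifferentiableOn ℂ (fun z => ∑' n, T (n + N) z) U := by
    refine differentiableOn_tsum_of_summable_norm
      (u := fun n : ℕ => (R + 1) * R * ((n + N : ℕ) : ℝ) ^ (-(3 / 2 : ℝ)))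
      ((summable_shift _ (by norm_num) N).mul_left _)
      (fun n => (differentiable_T _ (by lia)).differentiableOn) hUo ?_
    intro n z hz
    have hzn : ‖z‖ ≤ R := by have := hz.2; simp at this; exact this.le
    have hz1 : (1 / 2 : ℝ) < z.re := hz.1
    refine (norm_T_le _ (by lia) z (by linarith)).trans ?_
    gcongr
    · exact (norm_sub_le _ _).trans (by simpa using hzn)
    · exact_mod_cast (by lia : 1 ≤ n + N)
    · linarith
  have hg : DifferentiableOn ℂ (fun s : ℂ => (s - 1) * ∑ n ∈ Finset.range N, ((n : ℂ) + 1) ^ (-s)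
      + (N : ℂ) ^ (1 - s) + ∑' n, T (n + N) s) U := by
    refine DifferentiableOn.add (Differentiable.differentiableOn ?_) hT
    have a (n : ℕ) : Differentiable ℂ (fun s : ℂ => ((n : ℂ) + 1) ^ (-s)) := fun s =>
      DifferentiableAt.const_cpow (by fun_prop) (Or.inl (by exact_mod_cast Nat.succ_ne_zero n))
    have b : Differentiable ℂ (fun s : ℂ => (N : ℂ) ^ (1 - s)) := fun s =>
      DifferentiableAt.const_cpow (by fun_prop) (Or.inl (by exact_mod_cast (by lia : N ≠ 0)))
    fun_prop
  refine (hf.analyticOnNhd hUo).eqOn_of_preconnected_of_eventuallyEq (hg.analyticOnNhd hUo)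
    hUc.isPreconnected h2U ?_ hsU
  have : ∀ᶠ z : ℂ in 𝓝 2, 1 < z.re :=
    (isOpen_lt continuous_const continuous_re).mem_nhds (by simp)
  filter_upwards [this] with z hz
  rw [← zeta_formula_one_lt N hN z hz, riemannZeta_eq_inv_sub_mul (by rintro rfl; simp at hz)]
  have : z - 1 ≠ 0 := by
    intro h; have : z = 1 := by linear_combination h
    subst this; simp at hz
  field_simp

lemma zeta_bound : ∃ K : ℝ, 0 < K ∧ ∀ s : ℂ, 59 / 60 ≤ s.re → s.re ≤ 3 → 1 / 2 ≤ |s.im| →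
    ‖riemannZeta s‖ ≤ K * |s.im| ^ (1 / 30 : ℝ) := by
  set S : ℝ := ∑' n : ℕ, ((n + 1 : ℕ) : ℝ) ^ (-(61 / 60 : ℝ))
  have hSs := summable_shift (61 / 60) (by norm_num) 1
  have hS0 : 0 ≤ S := tsum_nonneg fun n => by positivity
  refine ⟨(S + 2 + 7 * S) * 3 ^ (1 / 30 : ℝ), by positivity, fun s h1 h2 h3 => ?_⟩
  set t := |s.im|
  set N := ⌈t⌉₊
  have hN : 1 ≤ N := Nat.one_le_iff_ne_zero.mpr (by
    have : 0 < N := Nat.ceil_pos.mpr (by linarith)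
    lia)
  have hNt : t ≤ N := Nat.le_ceil t
  have hNt2 : (N : ℝ) ≤ 3 * t := by
    have := Nat.ceil_lt_add_one (show 0 ≤ t by linarith)
    have : (N : ℝ) < t + 1 := this
    linarith
  have hN1 : (1 : ℝ) ≤ N := by exact_mod_cast hN
  have hs1 : t ≤ ‖s - 1‖ := by
    have := Complex.abs_im_le_norm (s - 1); simpa [t] using this
  have hsne : s - 1 ≠ 0 := by
    intro h; rw [h] at hs1; simp at hs1; linarith
  have hf := zeta_formula N hN s (by linarith)
  have hsn : ‖s‖ ≤ 7 * N := by
    have := Complex.norm_le_abs_re_add_abs_im s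
    rw [abs_of_pos (by linarith)] at this
    change _ ≤ _ + t at this
    linarith
  have hz : riemannZeta s = ∑ n ∈ Finset.range N, ((n : ℂ) + 1) ^ (-s)
      + (N : ℂ) ^ (1 - s) / (s - 1) + (∑' n, T (n + N) s) / (s - 1) := by
    rw [riemannZeta_eq_inv_sub_mul (sub_ne_zero.mp hsne), hf]; field_simp
  have b1 : ‖∑ n ∈ Finset.range N, ((n : ℂ) + 1) ^ (-s)‖ ≤ S * (N : ℝ) ^ (1 / 30 : ℝ) := by
    refine (norm_sum_le _ _).trans ?_
    calc _ ≤ ∑ n ∈ Finset.range N, ((n + 1 : ℕ) : ℝ) ^ (-(61 / 60 : ℝ)) * (N : ℝ) ^ (1 / 30 : ℝ) := by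
          refine Finset.sum_le_sum fun n hn => ?_
          have hn' : ((n + 1 : ℕ) : ℝ) ≤ N := by
            exact_mod_cast Finset.mem_range.mp hn
          have hp : (1 : ℝ) ≤ ((n + 1 : ℕ) : ℝ) := by exact_mod_cast (by lia : 1 ≤ n + 1)
          have := norm_natCast_cpow_of_pos (show 0 < n + 1 by lia) (-s)
          push_cast at this
          rw [this]
          push_cast at hp hn' ⊢
          calc ((n : ℝ) + 1) ^ (-s).re ≤ ((n : ℝ) + 1) ^ (-(61 / 60 : ℝ) + (1 / 30 : ℝ)) := by
                refine Real.rpow_le_rpow_of_exponent_le hp ?_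
                simp only [neg_re]; linarith
            _ = ((n : ℝ) + 1) ^ (-(61 / 60 : ℝ)) * ((n : ℝ) + 1) ^ (1 / 30 : ℝ) :=
                Real.rpow_add (by linarith) _ _
            _ ≤ _ := by gcongr
      _ = (∑ n ∈ Finset.range N, ((n + 1 : ℕ) : ℝ) ^ (-(61 / 60 : ℝ))) * (N : ℝ) ^ (1 / 30 : ℝ) := by
          rw [Finset.sum_mul]
      _ ≤ _ := by
          gcongr
          exact hSs.sum_le_tsum _ (fun n _ => by positivity)
  have b2 : ‖(N : ℂ) ^ (1 - s) / (s - 1)‖ ≤ 2 * (N : ℝ) ^ (1 / 30 : ℝ) := by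
    rw [norm_div, norm_natCast_cpow_of_pos (by lia), div_le_iff₀ (by linarith)]
    have : (N : ℝ) ^ (1 - s).re ≤ (N : ℝ) ^ (1 / 30 : ℝ) :=
      Real.rpow_le_rpow_of_exponent_le hN1 (by simp; linarith)
    nlinarith [Real.rpow_nonneg (show (0 : ℝ) ≤ N by linarith) (1 / 30 : ℝ)]
  have b3 : ‖(∑' n, T (n + N) s) / (s - 1)‖ ≤ 7 * S * (N : ℝ) ^ (1 / 30 : ℝ) := by
    rw [norm_div, div_le_iff₀ (by linarith)]
    have hterm : ∀ n, ‖T (n + N) s‖ ≤ (‖s - 1‖ * (7 * (N : ℝ) ^ (1 / 30 : ℝ))) *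
        ((n + 1 : ℕ) : ℝ) ^ (-(61 / 60 : ℝ)) := by
      intro n
      refine (norm_T_le _ (by lia) s (by linarith)).trans ?_
      have hp : (1 : ℝ) ≤ ((n + N : ℕ) : ℝ) := by exact_mod_cast (by lia : 1 ≤ n + N)
      have e1 : ((n + N : ℕ) : ℝ) ^ (-s.re - 1) ≤
          (N : ℝ) ^ (-(29 / 30) : ℝ) * ((n + 1 : ℕ) : ℝ) ^ (-(61 / 60 : ℝ)) := by
        calc _ ≤ ((n + N : ℕ) : ℝ) ^ (-(29 / 30 : ℝ) + (-(61 / 60 : ℝ))) :=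
              Real.rpow_le_rpow_of_exponent_le hp (by linarith)
          _ = ((n + N : ℕ) : ℝ) ^ (-(29 / 30 : ℝ)) * ((n + N : ℕ) : ℝ) ^ (-(61 / 60 : ℝ)) :=
              Real.rpow_add (by linarith) _ _
          _ ≤ _ := by
              refine mul_le_mul (Real.rpow_le_rpow_of_nonpos (by linarith) ?_ (by norm_num))
                (Real.rpow_le_rpow_of_nonpos (by positivity) ?_ (by norm_num))
                (by positivity) (by positivity)
              · exact_mod_cast (by lia : N ≤ n + N)
              · exact_mod_cast (by lia : n + 1 ≤ n + N)
      have e2 : (N : ℝ) * (N : ℝ) ^ (-(29 / 30) : ℝ) = (N : ℝ) ^ (1 / 30 : ℝ) := by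
        nth_rewrite 1 [← Real.rpow_one (N : ℝ)]
        rw [← Real.rpow_add (by linarith)]; norm_num
      calc _ ≤ ‖s - 1‖ * (7 * N) * ((N : ℝ) ^ (-(29 / 30) : ℝ) * ((n + 1 : ℕ) : ℝ) ^ (-(61 / 60 : ℝ))) := by
            gcongr
        _ = _ := by rw [← e2]; ring
    refine (tsum_of_norm_bounded (hSs.hasSum.mul_left _) hterm).trans (le_of_eq ?_)
    simp only [S]; ring
  have hNp : (N : ℝ) ^ (1 / 30 : ℝ) ≤ 3 ^ (1 / 30 : ℝ) * t ^ (1 / 30 : ℝ) := by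
    rw [← Real.mul_rpow (by norm_num) (by linarith)]
    gcongr
  calc ‖riemannZeta s‖ ≤ S * (N : ℝ) ^ (1 / 30 : ℝ) + 2 * (N : ℝ) ^ (1 / 30 : ℝ)
        + 7 * S * (N : ℝ) ^ (1 / 30 : ℝ) := by
        rw [hz]; exact (norm_add₃_le).trans (by gcongr)
    _ = (S + 2 + 7 * S) * (N : ℝ) ^ (1 / 30 : ℝ) := by ring
    _ ≤ (S + 2 + 7 * S) * (3 ^ (1 / 30 : ℝ) * t ^ (1 / 30 : ℝ)) := by gcongr
    _ = _ := by ring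


lemma ne_one_of_im {s : ℂ} (h : 1 / 2 ≤ |s.im|) : s ≠ 1 := by
  rintro rfl; simp at h; linarith

lemma zeta_deriv_bound : ∃ K : ℝ, 1 ≤ K ∧ ∀ n ≤ 3, ∀ s : ℂ, 1 ≤ s.re → s.re ≤ 2 → 1 ≤ |s.im| →
    ‖iteratedDeriv n riemannZeta s‖ ≤ K * |s.im| ^ (1 / 30 : ℝ) := by
  obtain ⟨K, hK, h⟩ := zeta_bound
  refine ⟨6 * (K * 2) * 60 ^ 3 + 1, by linarith [mul_pos hK hK], fun n hn s h1 h2 h3 => ?_⟩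
  have hz : ∀ z ∈ Metric.closedBall s (1 / 60), |z.re - s.re| ≤ 1 / 60 ∧ |z.im - s.im| ≤ 1 / 60 := by
    intro z hz
    rw [mem_closedBall_iff_norm] at hz
    exact ⟨(abs_re_le_norm (z - s)).trans hz, (abs_im_le_norm (z - s)).trans hz⟩
  have him : ∀ z ∈ Metric.closedBall s (1 / 60), 1 / 2 ≤ |z.im| ∧ |z.im| ≤ 2 * |s.im| := by
    intro z hz'
    obtain ⟨_, h5⟩ := hz z hz'
    have a := abs_sub_abs_le_abs_sub z.im s.im
    have b := abs_sub_abs_le_abs_sub s.im z.im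
    rw [abs_sub_comm] at b
    constructor <;> linarith
  have hd : DiffContOnCl ℂ riemannZeta (Metric.ball s (1 / 60)) := by
    apply DifferentiableOn.diffContOnCl_ball (U := Metric.closedBall s (1 / 60)) _ subset_rfl
    intro z hz
    exact (differentiableAt_riemannZeta (ne_one_of_im (him z hz).1)).differentiableWithinAt
  have := norm_iteratedDeriv_le_of_forall_mem_sphere_norm_le (C := K * 2 * |s.im| ^ (1 / 30 : ℝ)) n
    (show (0 : ℝ) < 1 / 60 by norm_num) hd (by
      intro z hz'
      have hz'' := Metric.sphere_subset_closedBall hz'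
      obtain ⟨h4, h5⟩ := hz z hz''
      obtain ⟨h6, h7⟩ := him z hz''
      rw [abs_le] at h4
      refine (h z (by linarith) (by linarith) h6).trans ?_
      rw [mul_assoc]
      gcongr
      calc |z.im| ^ (1 / 30 : ℝ) ≤ (2 * |s.im|) ^ (1 / 30 : ℝ) := by gcongr
        _ = 2 ^ (1 / 30 : ℝ) * |s.im| ^ (1 / 30 : ℝ) := Real.mul_rpow (by norm_num) (by positivity)
        _ ≤ 2 ^ (1 : ℝ) * |s.im| ^ (1 / 30 : ℝ) := by
            gcongr <;> norm_num
        _ = _ := by simp)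
  refine this.trans ?_
  have hf : (n.factorial : ℝ) ≤ 6 := by
    have := Nat.factorial_le hn
    exact_mod_cast this
  have hp : (60 : ℝ) ^ n ≤ 60 ^ 3 := pow_le_pow_right₀ (by norm_num) hn
  rw [div_eq_mul_inv, ← inv_pow, show ((1 : ℝ) / 60)⁻¹ = 60 by norm_num]
  have hT : 0 ≤ |s.im| ^ (1 / 30 : ℝ) := by positivity
  calc _ ≤ 6 * (K * 2 * |s.im| ^ (1 / 30 : ℝ)) * 60 ^ 3 := by gcongr
    _ ≤ _ := by nlinarith

lemma zeta_real_bound : ∃ K : ℝ, 1 ≤ K ∧ ∀ x : ℝ, 0 < x → x ≤ 1 →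
    ‖riemannZeta (1 + x)‖ ≤ K / x := by
  have hc : Continuous (fun x : ℝ => riemannZeta₁ (1 + x)) :=
    differentiable_riemannZeta₁.continuous.comp (by fun_prop)
  obtain ⟨K, hK⟩ := (isCompact_Icc (a := (0 : ℝ)) (b := 1)).exists_bound_of_continuousOn
    hc.continuousOn
  refine ⟨max K 1, le_max_right _ _, fun x h0 h1 => ?_⟩
  have hx : (1 : ℂ) + x ≠ 1 := by
    simpa using h0.ne'
  rw [riemannZeta_eq_inv_sub_mul hx, add_sub_cancel_left, norm_mul, norm_inv, norm_real,
    Real.norm_of_nonneg h0.le, inv_mul_eq_div]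
  gcongr
  exact (hK x ⟨h0.le, h1⟩).trans (le_max_left _ _)

lemma three_four_one {x : ℝ} (hx : 0 < x) (y : ℝ) :
    1 ≤ ‖riemannZeta (1 + x)‖ ^ 3 * ‖riemannZeta (1 + x + I * y)‖ ^ 4 *
      ‖riemannZeta (1 + x + 2 * I * y)‖ := by
  have := DirichletCharacter.norm_LFunction_product_ge_one (N := 1) 1 hx y
  simpa [DirichletCharacter.LFunctionTrivChar, DirichletCharacter.LFunction_modOne_eq] using this

lemma zeta_lower : ∃ c : ℝ, 0 < c ∧ c ≤ 1 ∧ ∀ s : ℂ, 1 < s.re → s.re ≤ 2 → 1 ≤ |s.im| →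
    c ≤ ‖riemannZeta s‖ * (|s.im| ^ (1 / 30 : ℝ)) ^ 4 := by
  obtain ⟨K1, hK1, h1⟩ := zeta_deriv_bound
  obtain ⟨K2, hK2, h2⟩ := zeta_real_bound
  obtain ⟨K, hKK, e1, e2⟩ : ∃ K : ℝ, 1 ≤ K ∧ K1 ≤ K ∧ K2 ^ 3 * (K1 * 2) ≤ K := by
    refine ⟨max K1 (K2 ^ 3 * (K1 * 2)), le_max_of_le_left hK1, le_max_left _ _, le_max_right _ _⟩
  have hK0 : 0 < K := by linarith
  -- pointwise lower bound from 3-4-1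
  have low : ∀ s : ℂ, 1 < s.re → s.re ≤ 2 → 1 ≤ |s.im| →
      (s.re - 1) ^ 3 ≤ K * |s.im| ^ (1 / 30 : ℝ) * ‖riemannZeta s‖ ^ 4 := by
    intro s a1 a2 a3
    set x := s.re - 1
    have hx : 0 < x := by simp only [x]; linarith
    have h341 := three_four_one hx s.im
    have es : (1 : ℂ) + x + I * s.im = s := by
      apply Complex.ext <;> simp [x]
    rw [es] at h341
    have b1 := h2 x hx (by simp only [x]; linarith)
    have b2 : ‖riemannZeta (1 + x + 2 * I * s.im)‖ ≤ K1 * 2 * |s.im| ^ (1 / 30 : ℝ) := by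
      have := h1 0 (by norm_num) (1 + x + 2 * I * s.im) (by simp [x]; linarith)
        (by simp [x]; linarith) (by simp [abs_mul]; linarith)
      rw [iteratedDeriv_zero] at this
      refine this.trans ?_
      rw [mul_assoc K1]
      refine mul_le_mul_of_nonneg_left ?_ (by linarith)
      have e : |((1 : ℂ) + x + 2 * I * s.im).im| = 2 * |s.im| := by simp [abs_mul]
      rw [e, Real.mul_rpow (by norm_num) (by positivity)]
      gcongr
      calc (2 : ℝ) ^ (1 / 30 : ℝ) ≤ 2 ^ (1 : ℝ) := by gcongr <;> norm_num
        _ = 2 := by simp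
    have hz : 0 ≤ ‖riemannZeta s‖ ^ 4 := by positivity
    have : 1 ≤ (K2 / x) ^ 3 * ‖riemannZeta s‖ ^ 4 * (K1 * 2 * |s.im| ^ (1 / 30 : ℝ)) :=
      h341.trans (by gcongr)
    have hx3 : 0 < x ^ 3 := by positivity
    calc x ^ 3 ≤ x ^ 3 * ((K2 / x) ^ 3 * ‖riemannZeta s‖ ^ 4 * (K1 * 2 * |s.im| ^ (1 / 30 : ℝ))) :=
          le_mul_of_one_le_right hx3.le this
      _ = K2 ^ 3 * (K1 * 2) * |s.im| ^ (1 / 30 : ℝ) * ‖riemannZeta s‖ ^ 4 := by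
          field_simp
      _ ≤ _ := by gcongr
  set c := 1 / (16 * K ^ 5) with hc
  have hc0 : 0 < c := by positivity
  have hKc : K ^ 5 * c = 1 / 16 := by rw [hc]; field_simp
  have hK5 : 1 ≤ K ^ 5 := one_le_pow₀ hKK
  have hc1 : c ≤ 1 / 16 := by
    rw [← hKc]; exact le_mul_of_one_le_left hc0.le hK5
  have hKc1 : K * c ≤ 1 := by
    have : K ≤ K ^ 5 := le_self_pow₀ hKK (by norm_num)
    nlinarith
  refine ⟨K * c, by positivity, hKc1, fun s a1 a2 a3 => ?_⟩
  set T := |s.im| ^ (1 / 30 : ℝ)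
  have hT : 1 ≤ T := Real.one_le_rpow a3 (by norm_num)
  have hT0 : 0 < T := by linarith
  set δ := c / T ^ 5 with hδ
  have hδ0 : 0 < δ := by positivity
  have hδ1 : δ ≤ 1 / 16 := by
    refine le_trans ?_ hc1
    exact div_le_self hc0.le (one_le_pow₀ hT)
  -- for re s ≥ 1 + δ
  have far : ∀ w : ℂ, 1 + δ ≤ w.re → w.re ≤ 2 → w.im = s.im → 2 * (K * c) ≤ ‖riemannZeta w‖ * T ^ 4 := by
    intro w b1 b2 b3
    have := low w (by linarith) b2 (by rw [b3]; exact a3)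
    rw [b3] at this
    have h3 : δ ^ 3 ≤ (w.re - 1) ^ 3 := by gcongr; linarith
    have h4 : δ ^ 3 * T ^ 16 ≤ K * T * ‖riemannZeta w‖ ^ 4 * T ^ 16 := by
      gcongr; exact h3.trans this
    have h5 : δ ^ 3 * T ^ 16 = c ^ 3 * T := by rw [hδ]; field_simp
    rw [h5] at h4
    have h6 : c ^ 3 ≤ K * (‖riemannZeta w‖ * T ^ 4) ^ 4 := by
      have : c ^ 3 * T ≤ K * (‖riemannZeta w‖ * T ^ 4) ^ 4 * T := by
        refine h4.trans (le_of_eq ?_); ring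
      exact le_of_mul_le_mul_right this hT0
    have h7 : K * (2 * (K * c)) ^ 4 = c ^ 3 := by
      calc _ = 16 * (K ^ 5 * c) * c ^ 3 := by ring
        _ = _ := by rw [hKc]; ring
    rw [← h7] at h6
    have h8 := le_of_mul_le_mul_left h6 hK0
    exact le_of_pow_le_pow_left₀ (by norm_num) (by positivity) h8
  rcases le_total (1 + δ) s.re with hs | hs
  · have := far s hs a2 rfl
    have : 0 < K * c := by positivity
    linarith
  · set w : ℂ := s + ((1 + δ - s.re : ℝ) : ℂ)
    have hwre : w.re = 1 + δ := by simp [w]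
    have hwim : w.im = s.im := by simp [w]
    have hfar := far w hwre.ge (by linarith) hwim
    have hseg : ‖riemannZeta w - riemannZeta s‖ ≤ K * T * ‖w - s‖ := by
      have hconv : Convex ℝ {z : ℂ | (1 ≤ z.re ∧ z.re ≤ 2) ∧ z.im = s.im} := by
        refine Convex.inter (Convex.inter (convex_halfSpace_re_ge 1) (convex_halfSpace_re_le 2)) ?_
        exact convex_hyperplane (f := Complex.imLm) (IsLinearMap.mk (by simp) (by simp)) _
      refine hconv.norm_image_sub_le_of_norm_deriv_le (f := riemannZeta) (C := K * T) ?_ ?_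
        ⟨⟨a1.le, a2⟩, rfl⟩ ⟨⟨by linarith, by linarith⟩, hwim⟩
      · rintro z ⟨⟨_, _⟩, hz⟩
        exact differentiableAt_riemannZeta (ne_one_of_im (by rw [hz]; linarith))
      · rintro z ⟨⟨z1, z2⟩, hz⟩
        have := h1 1 (by norm_num) z z1 z2 (by rw [hz]; exact a3)
        rw [iteratedDeriv_one, hz] at this
        exact this.trans (by simp only [T]; gcongr)
    have hws : ‖w - s‖ ≤ δ := by
      simp only [w, add_sub_cancel_left, norm_real, Real.norm_eq_abs]
      rw [abs_le]; constructor <;> linarith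
    have h9 : ‖riemannZeta w‖ ≤ ‖riemannZeta s‖ + K * T * δ := by
      have := norm_sub_norm_le (riemannZeta w) (riemannZeta s)
      have : K * T * ‖w - s‖ ≤ K * T * δ := by gcongr
      linarith
    have h10 : K * T * δ * T ^ 4 = K * c := by rw [hδ]; field_simp
    have h11 : ‖riemannZeta w‖ * T ^ 4 ≤ (‖riemannZeta s‖ + K * T * δ) * T ^ 4 := by gcongr
    rw [add_mul, h10] at h11
    linarith

/-- the Dirichlet series of `Λ - 1`. -/
noncomputable def F (s : ℂ) : ℂ := -deriv riemannZeta s / riemannZeta s - riemannZeta s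

lemma F2_formula {s : ℂ} (hs : 1 < s.re) :
    deriv (deriv F) s = -(deriv (deriv (deriv riemannZeta)) s / riemannZeta s
      - deriv (deriv riemannZeta) s / riemannZeta s * (deriv riemannZeta s / riemannZeta s)
      - 2 * (deriv riemannZeta s / riemannZeta s) * (deriv (deriv riemannZeta) s / riemannZeta s
        - (deriv riemannZeta s / riemannZeta s) ^ 2)) - deriv (deriv riemannZeta) s := by
  have hV : IsOpen {z : ℂ | 1 < z.re} := isOpen_lt continuous_const continuous_re
  have d0 : DifferentiableOn ℂ riemannZeta {z : ℂ | 1 < z.re} := fun z hz =>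
    (differentiableAt_riemannZeta (by rintro rfl; simp at hz)).differentiableWithinAt
  have d1 := d0.deriv hV
  have d2 := d1.deriv hV
  have hd0 : ∀ z : ℂ, 1 < z.re → HasDerivAt riemannZeta (deriv riemannZeta z) z := fun z hz =>
    (d0.differentiableAt (hV.mem_nhds hz)).hasDerivAt
  have hd1 : ∀ z : ℂ, 1 < z.re → HasDerivAt (deriv riemannZeta) (deriv (deriv riemannZeta) z) z :=
    fun z hz => (d1.differentiableAt (hV.mem_nhds hz)).hasDerivAt
  have hd2 : ∀ z : ℂ, 1 < z.re → HasDerivAt (deriv (deriv riemannZeta))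
      (deriv (deriv (deriv riemannZeta)) z) z :=
    fun z hz => (d2.differentiableAt (hV.mem_nhds hz)).hasDerivAt
  have hne : ∀ z : ℂ, 1 < z.re → riemannZeta z ≠ 0 := fun z hz =>
    riemannZeta_ne_zero_of_one_lt_re hz
  have hF1 : ∀ z : ℂ, 1 < z.re → deriv F z = -(deriv (deriv riemannZeta) z / riemannZeta z
      - (deriv riemannZeta z / riemannZeta z) ^ 2) - deriv riemannZeta z := by
    intro z hz
    have := (((hd1 z hz).neg.div (hd0 z hz) (hne z hz)).sub (hd0 z hz)).deriv
    have hz' := hne z hz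
    refine Eq.trans (by rfl) (this.trans ?_)
    simp only [Pi.neg_apply]
    field_simp
    ring
  have hF1' : deriv F =ᶠ[𝓝 s] fun z => -(deriv (deriv riemannZeta) z / riemannZeta z
      - (deriv riemannZeta z / riemannZeta z) ^ 2) - deriv riemannZeta z := by
    filter_upwards [hV.mem_nhds hs] with z hz using hF1 z hz
  rw [hF1'.deriv_eq]
  have hz' := hne s hs
  have := ((((hd2 s hs).div (hd0 s hs) hz').sub
    (((hd1 s hs).div (hd0 s hs) hz').pow 2)).neg.sub (hd1 s hs)).deriv
  refine Eq.trans (by rfl) (this.trans ?_)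
  simp only [Pi.div_apply, Nat.reduceSub, pow_one, Nat.cast_ofNat]
  field_simp

lemma F2_bound_large : ∃ K : ℝ, 0 < K ∧ ∀ s : ℂ, 1 < s.re → s.re ≤ 2 → 1 ≤ |s.im| →
    ‖deriv (deriv F) s‖ ≤ K * |s.im| ^ (1 / 2 : ℝ) := by
  obtain ⟨K, hK, h1⟩ := zeta_deriv_bound
  obtain ⟨c, hc, hc1, h2⟩ := zeta_lower
  set A := K / c with hA
  have hA1 : 1 ≤ A := by rw [hA, one_le_div hc]; linarith
  have hA0 : 0 < A := by linarith
  refine ⟨7 * A ^ 3, by positivity, fun s a1 a2 a3 => ?_⟩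
  rw [F2_formula a1]
  set T := |s.im| ^ (1 / 30 : ℝ) with hT'
  have hT : 1 ≤ T := Real.one_le_rpow a3 (by norm_num)
  have hlow := h2 s a1 a2 a3
  have hz0 : 0 < ‖riemannZeta s‖ := norm_pos_iff.mpr (riemannZeta_ne_zero_of_one_lt_re a1)
  have hq : ∀ n ≤ 3, ‖iteratedDeriv n riemannZeta s / riemannZeta s‖ ≤ A * T ^ 5 := by
    intro n hn
    have := h1 n hn s a1.le a2 a3
    rw [norm_div, div_le_iff₀ hz0]
    refine this.trans ?_
    calc K * T ≤ K / c * T * (‖riemannZeta s‖ * T ^ 4) := by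
          rw [div_mul_eq_mul_div, div_mul_eq_mul_div, le_div_iff₀ hc]
          gcongr
      _ = _ := by rw [hA]; ring
  have q1 := hq 1 (by norm_num)
  have q2 := hq 2 (by norm_num)
  have q3 := hq 3 (by norm_num)
  have r2 := h1 2 (by norm_num) s a1.le a2 a3
  simp only [iteratedDeriv_succ, iteratedDeriv_zero] at q1 q2 q3 r2
  set B := A * T ^ 5 with hB
  have hB1 : 1 ≤ B := by
    have : 1 ≤ T ^ 5 := one_le_pow₀ hT
    nlinarith
  have hKB : K * T ≤ B := by
    have : K ≤ A := by rw [hA, le_div_iff₀ hc]; nlinarith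
    have : T ≤ T ^ 5 := le_self_pow₀ hT (by norm_num)
    rw [hB]; gcongr
  generalize deriv (deriv (deriv riemannZeta)) s / riemannZeta s = x3 at *
  generalize deriv (deriv riemannZeta) s / riemannZeta s = x2 at *
  generalize deriv riemannZeta s / riemannZeta s = x1 at *
  generalize deriv (deriv riemannZeta) s = y2 at *
  have hfin : ‖-(x3 - x2 * x1 - 2 * x1 * (x2 - x1 ^ 2)) - y2‖ ≤
      (B + B * B + 2 * B * (B + B ^ 2)) + B := by
    refine (norm_sub_le _ _).trans (add_le_add ?_ (r2.trans hKB))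
    rw [norm_neg]
    refine (norm_sub_le _ _).trans (add_le_add ((norm_sub_le _ _).trans (add_le_add q3 ?_)) ?_)
    · rw [norm_mul]; gcongr
    · rw [norm_mul, norm_mul, Complex.norm_ofNat]
      have : ‖x2 - x1 ^ 2‖ ≤ B + B ^ 2 := by
        refine (norm_sub_le _ _).trans ?_
        rw [norm_pow]; gcongr
      gcongr
  refine hfin.trans ?_
  have hT15 : T ^ 15 = |s.im| ^ (1 / 2 : ℝ) := by
    rw [hT', ← Real.rpow_natCast, ← Real.rpow_mul (abs_nonneg _)]; norm_num
  have hB3 : B ^ 3 = A ^ 3 * |s.im| ^ (1 / 2 : ℝ) := by rw [← hT15, hB]; ring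
  have : B + B * B + 2 * B * (B + B ^ 2) + B ≤ 7 * B ^ 3 := by
    nlinarith [mul_nonneg (sub_nonneg.mpr hB1) (sub_nonneg.mpr hB1),
      mul_nonneg (mul_nonneg (sub_nonneg.mpr hB1) (sub_nonneg.mpr hB1)) (sub_nonneg.mpr hB1)]
  refine this.trans (le_of_eq ?_)
  rw [hB3]; ring

lemma F2_bound_small : ∃ K : ℝ, 0 < K ∧ ∀ s : ℂ, 1 < s.re → s.re ≤ 2 → |s.im| ≤ 1 →
    ‖deriv (deriv F) s‖ ≤ K := by
  set G : ℂ → ℂ := fun s => -deriv riemannZeta₁ s / riemannZeta₁ s - riemannZeta₀ s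
  set W : Set ℂ := {s | riemannZeta₁ s ≠ 0}
  have hW : IsOpen W := isOpen_ne_fun differentiable_riemannZeta₁.continuous continuous_const
  have hd1 : Differentiable ℂ (deriv riemannZeta₁) := differentiable_riemannZeta₁.deriv
  have hG : DifferentiableOn ℂ G W := by
    refine DifferentiableOn.sub (DifferentiableOn.div hd1.neg.differentiableOn
      differentiable_riemannZeta₁.differentiableOn (fun x hx => hx))
      differentiable_riemannZeta₀.differentiableOn
  have hG2 := ((hG.deriv hW).deriv hW).continuousOn
  have hcomp : IsCompact (Set.Icc (1 : ℝ) 2 ×ℂ Set.Icc (-1 : ℝ) 1) :=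
    isCompact_Icc.reProdIm isCompact_Icc
  have hsub : (Set.Icc (1 : ℝ) 2 ×ℂ Set.Icc (-1 : ℝ) 1) ⊆ W := by
    intro s hs
    by_cases h1 : s = 1
    · subst h1; simp [W]
    · have := riemannZeta_ne_zero_of_one_le_re hs.1.1
      rw [riemannZeta_eq_inv_sub_mul h1] at this
      exact right_ne_zero_of_mul this
  obtain ⟨K, hK⟩ := hcomp.exists_bound_of_continuousOn (hG2.mono hsub)
  refine ⟨max K 1, by positivity, fun s a1 a2 a3 => ?_⟩
  have hV : IsOpen {z : ℂ | 1 < z.re} := isOpen_lt continuous_const continuous_re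
  have hFG : Set.EqOn F G {z : ℂ | 1 < z.re} := by
    intro z hz
    have hz1 : z ≠ 1 := by rintro rfl; simp at hz
    have hz0 : z - 1 ≠ 0 := sub_ne_zero.mpr hz1
    have hne := riemannZeta_ne_zero_of_one_lt_re hz
    have e1 := riemannZeta_eq_inv_sub_mul hz1
    have hne1 : riemannZeta₁ z ≠ 0 := by rw [e1] at hne; exact right_ne_zero_of_mul hne
    have e2 := deriv_riemannZeta_eq_neg_inv_sub_sq_mul_add hz1
    simp only [F, G]
    rw [e2]
    have : -(-(z - 1)⁻¹ ^ 2 * riemannZeta₁ z + (z - 1)⁻¹ * deriv riemannZeta₁ z) / riemannZeta z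
      = (z - 1)⁻¹ - deriv riemannZeta₁ z / riemannZeta₁ z := by
      rw [e1]; field_simp; ring
    rw [this, riemannZeta_eq_inv_sub_add hz1]
    ring
  have e1 := hFG.deriv hV
  have e2 := e1.deriv hV a1
  rw [e2]
  exact (hK s ⟨⟨a1.le, a2⟩, abs_le.mp a3⟩).trans (le_max_left _ _)

lemma F2_bound : ∃ K : ℝ, 0 < K ∧ ∀ s : ℂ, 1 < s.re → s.re ≤ 2 →
    ‖deriv (deriv F) s‖ ≤ K * (1 + |s.im|) ^ (1 / 2 : ℝ) := by
  obtain ⟨K, hK, h1⟩ := F2_bound_large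
  obtain ⟨K', hK', h2⟩ := F2_bound_small
  refine ⟨K + K', by positivity, fun s a1 a2 => ?_⟩
  have hp : 1 ≤ (1 + |s.im|) ^ (1 / 2 : ℝ) := Real.one_le_rpow (by simp) (by norm_num)
  rcases le_total 1 |s.im| with h | h
  · refine (h1 s a1 a2 h).trans ?_
    gcongr <;> linarith
  · refine (h2 s a1 a2 h).trans ?_
    nlinarith

noncomputable def a (n : ℕ) : ℝ := (ArithmeticFunction.vonMangoldt n - 1) * Real.log n ^ 2

lemma F_eq_LSeries {s : ℂ} (hs : 1 < s.re) :
    F s = LSeries ((fun n => (ArithmeticFunction.vonMangoldt n : ℂ)) - 1) s := by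
  rw [LSeries_sub (ArithmeticFunction.LSeriesSummable_vonMangoldt hs)
    (LSeriesSummable_one_iff.2 hs), LSeries_one_eq_riemannZeta hs,
    ArithmeticFunction.LSeries_vonMangoldt_eq_deriv_riemannZeta_div hs, F]

lemma abscissa_le : LSeries.abscissaOfAbsConv
    ((fun n => (ArithmeticFunction.vonMangoldt n : ℂ)) - 1) ≤ 1 := by
  apply LSeries.abscissaOfAbsConv_le_of_forall_lt_LSeriesSummable (x := 1)
  intro y hy
  exact (ArithmeticFunction.LSeriesSummable_vonMangoldt (by simpa)).sub
    (LSeriesSummable_one_iff.2 (by simpa))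

lemma logMul_eq : LSeries.logMul^[2] ((fun n => (ArithmeticFunction.vonMangoldt n : ℂ)) - 1)
    = fun n => (a n : ℂ) := by
  funext n
  simp [LSeries.logMul, a]
  ring

lemma summable_a {s : ℂ} (hs : 1 < s.re) : LSeriesSummable (fun n => (a n : ℂ)) s := by
  rw [← logMul_eq]
  apply LSeriesSummable_of_abscissaOfAbsConv_lt_re
  rw [LSeries.absicssaOfAbsConv_logPowMul]
  exact abscissa_le.trans_lt (by exact_mod_cast hs)

lemma F2_eq {s : ℂ} (hs : 1 < s.re) : deriv (deriv F) s = LSeries (fun n => (a n : ℂ)) s := by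
  have h := LSeries_iteratedDeriv 2 (s := s) (abscissa_le.trans_lt (by exact_mod_cast hs))
  rw [logMul_eq] at h
  have ho : IsOpen {s : ℂ | 1 < s.re} := isOpen_lt continuous_const continuous_re
  have e : Set.EqOn F (LSeries ((fun n => (ArithmeticFunction.vonMangoldt n : ℂ)) - 1))
    {s : ℂ | 1 < s.re} := fun s hs => F_eq_LSeries hs
  have e2 := (e.deriv ho).deriv ho hs
  rw [e2]
  simpa [iteratedDeriv_succ] using h

noncomputable def chi : ℝ → ℂ := Set.indicator (Set.Ioc 0 1) (fun _ => 1 : ℝ → ℂ)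

lemma mellin_logchi {s : ℂ} (hs : 0 < s.re) :
    MellinConvergent (fun t => Real.log t • chi t) s ∧
      mellin (fun t => Real.log t • chi t) s = -1 / s ^ 2 := by
  have hL : MeasureTheory.LocallyIntegrableOn chi (Set.Ioi 0) := by
    apply MeasureTheory.LocallyIntegrable.locallyIntegrableOn
    apply MeasureTheory.Integrable.locallyIntegrable
    unfold chi
    rw [MeasureTheory.integrable_indicator_iff measurableSet_Ioc]
    simp
  have htop : chi =O[atTop] (fun t : ℝ => t ^ (-(s.re + 1))) := by
    apply Asymptotics.IsBigO.of_bound 1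
    filter_upwards [eventually_gt_atTop 1] with t ht
    have : t ∉ Set.Ioc (0:ℝ) 1 := fun h => by linarith [h.2]
    rw [chi, Set.indicator_of_notMem this]
    simp
  have hbot : chi =O[𝓝[>] 0] (fun t : ℝ => t ^ (-(0:ℝ))) := by
    apply Asymptotics.IsBigO.of_bound 1
    refine Eventually.of_forall fun t => ?_
    simp only [neg_zero, Real.rpow_zero, chi]
    by_cases h : t ∈ Set.Ioc (0:ℝ) 1
    · simp [Set.indicator_of_mem h]
    · simp [Set.indicator_of_notMem h]
  have h := mellin_hasDerivAt_of_isBigO_rpow hL htop (by linarith) hbot hs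
  refine ⟨h.1, ?_⟩
  have hs0 : s ≠ 0 := by rintro rfl; simp at hs
  have h2 : mellin chi =ᶠ[𝓝 s] fun z => z⁻¹ := by
    have ho : IsOpen {s : ℂ | 0 < s.re} := isOpen_lt continuous_const continuous_re
    filter_upwards [ho.mem_nhds hs] with z hz
    have := (hasMellin_one_Ioc hz).2
    rw [← one_div]; exact this
  have h3 := h.2.congr_of_eventuallyEq h2.symm
  rw [h3.unique (hasDerivAt_inv hs0)]
  rw [neg_div, one_div]

lemma norm_sq_ge {σ : ℝ} (hσ : 1 ≤ σ) (t : ℝ) : (1 + |t|) ^ 2 / 2 ≤ ‖(σ + t * I : ℂ)‖ ^ 2 := by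
  rw [← normSq_eq_norm_sq, normSq_apply]
  simp
  nlinarith [sq_nonneg (1 - |t|), sq_abs t]

lemma s_ne {σ : ℝ} (hσ : 1 ≤ σ) (t : ℝ) : (σ + t * I : ℂ) ≠ 0 := by
  intro h
  have := congrArg re h
  simp at this
  linarith

lemma cont_kernel {σ : ℝ} (hσ : 1 ≤ σ) : Continuous (fun t : ℝ => 1 / (σ + t * I : ℂ) ^ 2) := by
  refine Continuous.div continuous_const (by fun_prop) fun t => pow_ne_zero _ (s_ne hσ t)

lemma integrable_kernel {σ : ℝ} (hσ : 1 ≤ σ) :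
    MeasureTheory.Integrable (fun t : ℝ => 1 / (σ + t * I : ℂ) ^ 2) := by
  have h1 : MeasureTheory.Integrable (fun t : ℝ => 2 * (1 + ‖t‖) ^ (-2 : ℝ)) :=
    (integrable_one_add_norm (by simp)).const_mul 2
  refine h1.mono' (cont_kernel hσ).aestronglyMeasurable (Eventually.of_forall fun t => ?_)
  rw [norm_div, norm_one, norm_pow, Real.rpow_neg (by positivity), Real.norm_eq_abs]
  have := norm_sq_ge hσ t
  have h0 : 0 < (1 + |t|) ^ 2 := by positivity
  rw [div_le_iff₀ (by linarith)]
  norm_cast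
  rw [mul_assoc, inv_mul_eq_div, ← mul_div_assoc, le_div_iff₀ h0]
  linarith

lemma perron {σ : ℝ} (hσ : 1 ≤ σ) {y : ℝ} (hy : 0 < y) :
    ∫ t : ℝ, (y : ℂ) ^ (σ + t * I : ℂ) / (σ + t * I : ℂ) ^ 2 =
      (2 * Real.pi * max 0 (Real.log y) : ℝ) := by
  have hs : 0 < (σ : ℂ).re := by simp; linarith
  have hr : ∀ t : ℝ, mellin (fun t => Real.log t • chi t) (σ + t * I) = -1 / (σ + t * I) ^ 2 :=
    fun t => (mellin_logchi (by simp; linarith)).2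
  have hv : VerticalIntegrable (mellin (fun t => Real.log t • chi t)) σ := by
    unfold VerticalIntegrable
    simp_rw [hr, neg_div]
    exact (integrable_kernel hσ).neg
  have hval : ∀ x : ℝ, 0 < x → Real.log x • chi x = ((min 0 (Real.log x) : ℝ) : ℂ) := by
    intro x hx
    rcases le_or_gt x 1 with h | h
    · have : x ∈ Set.Ioc (0:ℝ) 1 := ⟨hx, h⟩
      simp [chi, Set.indicator_of_mem this, min_eq_right (Real.log_nonpos hx.le h)]
    · have : x ∉ Set.Ioc (0:ℝ) 1 := fun h' => by linarith [h'.2]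
      rw [chi, Set.indicator_of_notMem this, min_eq_left (Real.log_nonneg h.le)]; simp
  have hx : 0 < y⁻¹ := by positivity
  have hc : ContinuousAt (fun t => Real.log t • chi t) y⁻¹ := by
    have : (fun t => ((min 0 (Real.log t) : ℝ) : ℂ)) =ᶠ[𝓝 y⁻¹] fun t => Real.log t • chi t := by
      filter_upwards [lt_mem_nhds hx] with t ht
      exact (hval t ht).symm
    refine ContinuousAt.congr ?_ this
    have := Real.continuousAt_log hx.ne'
    refine continuous_ofReal.continuousAt.comp ?_
    exact continuousAt_const.min this
  have h := mellinInv_mellin_eq σ _ hx (mellin_logchi hs).1 hv hc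
  rw [hval _ hx, mellinInv] at h
  have e : ∀ t : ℝ, ((y⁻¹ : ℝ) : ℂ) ^ (-(σ + t * I : ℂ)) • mellin (fun t => Real.log t • chi t) (σ + t * I)
      = -((y : ℂ) ^ (σ + t * I : ℂ) / (σ + t * I : ℂ) ^ 2) := by
    intro t
    rw [hr, ofReal_inv, Complex.inv_cpow, Complex.cpow_neg, inv_inv, smul_eq_mul]
    · ring
    · rw [Complex.arg_ofReal_of_nonneg hy.le]; exact Real.pi_pos.ne
  simp_rw [e] at h
  rw [MeasureTheory.integral_neg, Real.log_inv] at h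
  have hpi : (Real.pi : ℂ) ≠ 0 := by exact_mod_cast Real.pi_ne_zero
  have : min 0 (-Real.log y) = - max 0 (Real.log y) := by
    have := max_neg_neg 0 (-Real.log y); simp at this; linarith
  rw [this] at h
  rw [real_smul] at h
  push_cast at h ⊢
  field_simp at h
  linear_combination -h

noncomputable def B (X : ℝ) : ℝ := ∑ n ∈ Finset.range (⌊X⌋₊ + 1), a n * Real.log (X / n)

lemma B_tsum {X : ℝ} (hX : 1 ≤ X) : ∑' n : ℕ, a n * max 0 (Real.log (X / n)) = B X := by
  rw [tsum_eq_sum (s := Finset.range (⌊X⌋₊ + 1))]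
  · apply Finset.sum_congr rfl
    intro n hn
    rcases Nat.eq_zero_or_pos n with rfl | h0
    · simp
    have h0' : (0:ℝ) < n := by exact_mod_cast h0
    rw [max_eq_right]
    apply Real.log_nonneg
    rw [le_div_iff₀ h0', one_mul]
    exact (Nat.le_floor_iff (by linarith)).1 (by simpa [Nat.lt_succ_iff] using hn)
  · intro n hn
    have h1 : X < n := by
      rw [← Nat.floor_lt (by linarith)]; simp at hn; omega
    rw [max_eq_left, mul_zero]
    apply Real.log_nonpos (by positivity)
    rw [div_le_one (by linarith)]; exact h1.le

lemma kernel_term {X : ℝ} (hX : 1 ≤ X) (n : ℕ) (s : ℂ) :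
    LSeries.term (fun n => (a n : ℂ)) s n * ((X : ℂ) ^ s / s ^ 2)
      = (a n : ℂ) * (((X / n : ℝ) : ℂ) ^ s / s ^ 2) := by
  rcases Nat.eq_zero_or_pos n with rfl | h0
  · simp [a]
  have := div_cpow_ofReal_nonneg (show 0 ≤ X by linarith) (Nat.cast_nonneg (α := ℝ) n) s
  rw [LSeries.term_of_ne_zero h0.ne', ofReal_div, this, ofReal_natCast]
  ring

lemma B_bound_sigma : ∃ K : ℝ, 0 < K ∧ ∀ X : ℝ, 1 ≤ X → ∀ σ : ℝ, 1 < σ → σ ≤ 2 →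
    |B X| ≤ K * X ^ σ := by
  obtain ⟨K, hK, hF⟩ := F2_bound
  have hKer : MeasureTheory.Integrable (fun t : ℝ => (1 + ‖t‖) ^ (-(3/2) : ℝ)) :=
    integrable_one_add_norm (by simp; norm_num)
  set J := ∫ t : ℝ, (1 + ‖t‖) ^ (-(3/2) : ℝ) with hJ
  have hJ0 : 0 ≤ J := MeasureTheory.integral_nonneg fun t => by positivity
  refine ⟨2 * K * J + 1, by positivity, fun X hX σ hσ hσ2 => ?_⟩
  have hX0 : 0 < X := by linarith
  let G : ℕ → ℝ → ℂ := fun n t => LSeries.term (fun n => (a n : ℂ)) (σ + t * I) n *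
    ((X : ℂ) ^ (σ + t * I : ℂ) / (σ + t * I : ℂ) ^ 2)
  have hGn : ∀ n t, ‖G n t‖ = ‖LSeries.term (fun n => (a n : ℂ)) σ n‖ * X ^ σ *
      ‖1 / (σ + t * I : ℂ) ^ 2‖ := by
    intro n t
    simp only [G]
    rw [norm_mul, div_eq_mul_one_div, norm_mul, Complex.norm_cpow_eq_rpow_re_of_pos hX0,
      LSeries.norm_term_eq, LSeries.norm_term_eq]
    simp [mul_assoc]
  have hGm : ∀ n, Continuous (G n) := by
    intro n
    have hX1 : (X:ℂ) ≠ 0 := by exact_mod_cast hX0.ne'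
    have h1 : Continuous fun t : ℝ => LSeries.term (fun n => (a n : ℂ)) (σ + t * I) n := by
      rcases Nat.eq_zero_or_pos n with rfl | h0
      · simp [LSeries.term_zero, continuous_const]
      have hn : (n:ℂ) ≠ 0 := by exact_mod_cast h0.ne'
      simp_rw [LSeries.term_of_ne_zero h0.ne']
      refine continuous_const.div ?_ ?_
      · exact Continuous.const_cpow (by fun_prop) (Or.inl hn)
      · intro t; simp [Complex.cpow_eq_zero_iff, hn]
    have h2 : Continuous fun t : ℝ => (X : ℂ) ^ (σ + t * I : ℂ) :=
      Continuous.const_cpow (by fun_prop) (Or.inl hX1)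
    have := h1.mul (h2.mul (cont_kernel hσ.le))
    convert this using 2
    simp [G, div_eq_mul_inv]
    rfl
  have hGi : ∀ n, MeasureTheory.Integrable (G n) := by
    intro n
    refine ((integrable_kernel hσ.le).norm.const_mul
      (‖LSeries.term (fun n => (a n : ℂ)) σ n‖ * X ^ σ)).mono' (hGm n).aestronglyMeasurable
      (Eventually.of_forall fun t => (hGn n t).le)
  have hsum : Summable fun n => ∫ t, ‖G n t‖ := by
    simp_rw [hGn, MeasureTheory.integral_const_mul]
    refine Summable.mul_right _ (Summable.mul_right _ ?_)
    exact (summable_a (s := (σ:ℂ)) (by simpa)).norm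
  have key := MeasureTheory.integral_tsum_of_summable_integral_norm hGi hsum
  have hl : ∀ n, ∫ t, G n t = ((2 * Real.pi * (a n * max 0 (Real.log (X / n))) : ℝ) : ℂ) := by
    intro n
    simp only [G]
    simp_rw [kernel_term hX, MeasureTheory.integral_const_mul]
    rcases Nat.eq_zero_or_pos n with rfl | h0
    · simp [a]
    have h0' : (0:ℝ) < n := by exact_mod_cast h0
    rw [perron hσ.le (by positivity)]
    push_cast; ring
  simp_rw [hl] at key
  rw [← ofReal_tsum, tsum_mul_left, B_tsum hX] at key
  have hb : ‖∫ t, ∑' n, G n t‖ ≤ ∫ t : ℝ, (2 * K * X ^ σ) * (1 + ‖t‖) ^ (-(3/2) : ℝ) := by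
    refine MeasureTheory.norm_integral_le_of_norm_le (hKer.const_mul _)
      (Eventually.of_forall fun t => ?_)
    simp only [G]
    rw [tsum_mul_right]
    change ‖LSeries (fun n => (a n : ℂ)) (σ + t * I) * _‖ ≤ _
    rw [← F2_eq (by simpa), norm_mul, norm_div, norm_pow,
      Complex.norm_cpow_eq_rpow_re_of_pos hX0]
    have h1 := hF (σ + t * I) (by simpa) (by simpa)
    have h2 := norm_sq_ge hσ.le t
    simp only [add_re, ofReal_re, mul_re, I_re, mul_zero, ofReal_im, I_im, mul_one, sub_self,
      add_zero, add_im, mul_im, zero_add] at h1 ⊢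
    have h0 : 0 < 1 + |t| := by positivity
    have e : (1 + |t|) ^ (1/2:ℝ) = (1 + |t|) ^ (-(3/2):ℝ) * (1 + |t|) ^ 2 := by
      rw [← Real.rpow_natCast, ← Real.rpow_add h0]; norm_num
    rw [Real.norm_eq_abs]
    have hp : 0 < (1 + |t|) ^ 2 := by positivity
    calc _ ≤ (K * (1 + |t|) ^ (1 / 2 : ℝ)) * (X ^ σ / ((1 + |t|) ^ 2 / 2)) := by gcongr
      _ = _ := by
        rw [e]; field_simp
  rw [← key, MeasureTheory.integral_const_mul, norm_real, Real.norm_eq_abs, abs_mul,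
    abs_of_pos (by positivity)] at hb
  have hpi := Real.pi_gt_three
  have : |B X| ≤ 2 * Real.pi * |B X| := by nlinarith [abs_nonneg (B X)]
  have hXs : 0 < X ^ σ := by positivity
  nlinarith

lemma B_bound : ∃ K : ℝ, 0 < K ∧ ∀ X : ℝ, 1 ≤ X → |B X| ≤ K * X := by
  obtain ⟨K, hK, h⟩ := B_bound_sigma
  refine ⟨K, hK, fun X hX => ?_⟩
  have ht : Tendsto (fun σ : ℝ => K * X ^ σ) (𝓝[>] 1) (𝓝 (K * X ^ (1:ℝ))) := by
    refine Tendsto.mono_left ?_ nhdsWithin_le_nhds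
    exact ((Real.continuous_const_rpow (by linarith)).const_mul K).tendsto 1
  rw [Real.rpow_one] at ht
  refine ge_of_tendsto ht ?_
  filter_upwards [Ioc_mem_nhdsGT (show (1:ℝ) < 2 by norm_num)] with σ hσ
  exact h X hX σ hσ.1 hσ.2

noncomputable def D (X : ℝ) : ℝ := ∑ n ∈ Finset.range (⌊X⌋₊ + 1), a n

lemma neg_a_le (n : ℕ) : -a n ≤ Real.log n ^ 2 := by
  have := ArithmeticFunction.vonMangoldt_nonneg (n := n)
  unfold a
  nlinarith [sq_nonneg (Real.log n)]

lemma unsmooth {x y : ℝ} (hx : 1 ≤ x) (hxy : x ≤ y) :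
    Real.log (y / x) * D x ≤ B y - B x + (y - x + 1) * (Real.log y ^ 2 * Real.log (y / x)) ∧
    B y - B x - (y - x + 1) * (Real.log y ^ 2 * Real.log (y / x)) ≤ Real.log (y / x) * D y := by
  have hy : 1 ≤ y := hx.trans hxy
  have hfl : ⌊x⌋₊ + 1 ≤ ⌊y⌋₊ + 1 := by gcongr
  set S := Finset.Ico (⌊x⌋₊ + 1) (⌊y⌋₊ + 1) with hS
  have hL : 0 ≤ Real.log (y / x) := Real.log_nonneg (by rw [le_div_iff₀ (by linarith)]; linarith)
  have hBy : B y = ∑ n ∈ Finset.range (⌊x⌋₊ + 1), a n * Real.log (y / n) +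
      ∑ n ∈ S, a n * Real.log (y / n) := (Finset.sum_range_add_sum_Ico _ hfl).symm
  have hDy : D y = D x + ∑ n ∈ S, a n := (Finset.sum_range_add_sum_Ico _ hfl).symm
  have h1 : ∑ n ∈ Finset.range (⌊x⌋₊ + 1), a n * Real.log (y / n) =
      B x + Real.log (y / x) * D x := by
    unfold B D
    rw [Finset.mul_sum, ← Finset.sum_add_distrib]
    apply Finset.sum_congr rfl
    intro n _
    rcases Nat.eq_zero_or_pos n with rfl | h0
    · simp [a]
    have h0' : (0:ℝ) < n := by exact_mod_cast h0
    rw [Real.log_div (by linarith) h0'.ne', Real.log_div (by linarith) h0'.ne',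
      Real.log_div (by linarith) (by linarith)]
    ring
  have hmem : ∀ n ∈ S, x < n ∧ (n:ℝ) ≤ y := by
    intro n hn
    rw [hS, Finset.mem_Ico] at hn
    constructor
    · rw [← Nat.floor_lt (by linarith)]; omega
    · exact (Nat.le_floor_iff (by linarith)).1 (by omega)
  have hcard : (S.card : ℝ) ≤ y - x + 1 := by
    rw [hS, Nat.card_Ico, Nat.cast_sub hfl]
    push_cast
    have := Nat.floor_le (show 0 ≤ y by linarith)
    have := Nat.lt_floor_add_one x
    linarith
  have hR : 0 ≤ Real.log y ^ 2 * Real.log (y / x) := by positivity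
  have hsum : ∀ f : ℕ → ℝ, (∀ n ∈ S, 0 ≤ f n ∧ f n ≤ Real.log (y / x)) →
      ∑ n ∈ S, -a n * f n ≤ (y - x + 1) * (Real.log y ^ 2 * Real.log (y / x)) := by
    intro f hf
    calc ∑ n ∈ S, -a n * f n ≤ ∑ n ∈ S, Real.log y ^ 2 * Real.log (y / x) := by
          apply Finset.sum_le_sum
          intro n hn
          obtain ⟨h1, h2⟩ := hmem n hn
          obtain ⟨h3, h4⟩ := hf n hn
          have h5 : Real.log n ≤ Real.log y := Real.log_le_log (by linarith) h2
          have h6 : 0 ≤ Real.log n := Real.log_nonneg (by linarith)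
          calc -a n * f n ≤ Real.log n ^ 2 * f n := mul_le_mul_of_nonneg_right (neg_a_le n) h3
            _ ≤ _ := by gcongr
      _ = S.card * (Real.log y ^ 2 * Real.log (y / x)) := by simp
      _ ≤ _ := by gcongr
  constructor
  · have := hsum (fun n => Real.log (y / n)) (by
      intro n hn
      obtain ⟨h1, h2⟩ := hmem n hn
      constructor
      · exact Real.log_nonneg (by rw [le_div_iff₀ (by linarith)]; linarith)
      · apply Real.log_le_log (div_pos (by linarith) (by linarith))
        gcongr)
    simp only [neg_mul, Finset.sum_neg_distrib] at this
    linarith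
  · have := hsum (fun n => Real.log (y / x) - Real.log (y / n)) (by
      intro n hn
      obtain ⟨h1, h2⟩ := hmem n hn
      constructor
      · rw [sub_nonneg]
        apply Real.log_le_log (div_pos (by linarith) (by linarith))
        gcongr
      · have := Real.log_nonneg (show 1 ≤ y / n by rw [le_div_iff₀ (by linarith)]; linarith)
        linarith)
    simp only [neg_mul, Finset.sum_neg_distrib, mul_sub, Finset.sum_sub_distrib,
      ← Finset.sum_mul] at this
    rw [hDy]
    linarith

lemma D_bound : ∃ K : ℝ, 0 < K ∧ ∀ x : ℝ, 3 ≤ x → |D x| ≤ K * (x * Real.log x) := by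
  obtain ⟨K, hK, hB⟩ := B_bound
  refine ⟨8 * K + 8, by positivity, fun x hx => ?_⟩
  set l := Real.log x with hl
  have hl1 : 1 ≤ l := by
    rw [hl, Real.le_log_iff_exp_le (by linarith)]
    linarith [Real.exp_one_lt_d9]
  have hlx : l ≤ x := by linarith [Real.log_le_sub_one_of_pos (show 0 < x by linarith)]
  set h := 1 / l with hh
  have hh0 : 0 < h := by positivity
  have hh1 : h ≤ 1 := by rw [hh, div_le_one (by linarith)]; exact hl1
  have hlh : l * h = 1 := by rw [hh]; field_simp
  have hlog : h / 2 ≤ Real.log (1 + h) := by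
    have := Real.one_sub_inv_le_log_of_pos (show 0 < 1 + h by linarith)
    refine le_trans ?_ this
    have e : 1 - (1 + h)⁻¹ = h / (1 + h) := by field_simp; ring
    rw [e]
    gcongr; linarith
  set L := Real.log (1 + h) with hL
  have hL0 : 0 < L := by linarith
  have hLl : 1 ≤ 2 * l * L := by nlinarith
  have hxh : 1 ≤ x * h := by nlinarith
  rw [abs_le]
  constructor
  · have hx1 : 1 ≤ x / (1 + h) := by rw [le_div_iff₀ (by linarith)]; linarith
    have hx2 : x / (1 + h) ≤ x := div_le_self (by linarith) (by linarith)
    have hu := (unsmooth hx1 hx2).2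
    have e : x / (x / (1 + h)) = 1 + h := by field_simp
    rw [e] at hu
    have b1 := (abs_le.1 (hB x (by linarith))).1
    have b2 := (abs_le.1 (hB _ hx1)).2
    have b3 : K * (x / (1 + h)) ≤ K * x := by gcongr
    have b4 : x - x / (1 + h) ≤ x * h := by
      have e : x - x / (1 + h) = x * h / (1 + h) := by field_simp; ring
      rw [e]
      exact div_le_self (by positivity) (by linarith)
    have b5 : (x - x / (1 + h) + 1) * (l ^ 2 * L) ≤ (2 * (x * h)) * (l ^ 2 * L) := by
      gcongr; linarith
    have b6 : (2 * (x * h)) * (l ^ 2 * L) = 2 * x * l * L * (l * h) := by ring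
    rw [b6, hlh] at b5
    have b7 : -(2 * K * x) ≥ - (2 * K * x * (2 * l * L)) := by
      have : 0 < K * x := by positivity
      nlinarith
    have b8 : L * (-((4 * K + 2) * (x * l))) ≤ L * D x := by nlinarith
    have b9 := le_of_mul_le_mul_left b8 hL0
    have : 0 ≤ x * l := by positivity
    nlinarith
  · have hxy : x ≤ x * (1 + h) := by nlinarith
    have hu := (unsmooth (show 1 ≤ x by linarith) hxy).1
    have e : x * (1 + h) / x = 1 + h := by field_simp
    rw [e] at hu
    have b1 := (abs_le.1 (hB x (by linarith))).1
    have b2 := (abs_le.1 (hB (x * (1 + h)) (by linarith))).2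
    have b3 : K * (x * (1 + h)) ≤ K * (x * 2) := by gcongr; linarith
    have e2 : Real.log (x * (1 + h)) = l + L := Real.log_mul (by linarith) (by linarith)
    have hLle : L ≤ l := by
      have := Real.log_le_sub_one_of_pos (show 0 < 1 + h by linarith)
      linarith
    rw [e2] at hu
    have b5 : (x * (1 + h) - x + 1) * ((l + L) ^ 2 * L) ≤ (2 * (x * h)) * ((2 * l) ^ 2 * L) := by
      gcongr
      · linarith
      · linarith
    have b6 : (2 * (x * h)) * ((2 * l) ^ 2 * L) = 8 * x * l * L * (l * h) := by ring
    rw [b6, hlh] at b5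
    have b7 : 3 * K * x ≤ 3 * K * x * (2 * l * L) := by
      have : 0 < K * x := by positivity
      nlinarith
    have b8 : L * D x ≤ L * ((6 * K + 8) * (x * l)) := by nlinarith
    have b9 := le_of_mul_le_mul_left b8 hL0
    have : 0 ≤ K * (x * l) := by positivity
    nlinarith

lemma W_bound : ∃ K : ℝ, 0 < K ∧ ∀ N : ℕ,
    ∑ n ∈ Finset.Ioc 0 N, (ArithmeticFunction.vonMangoldt n + 1) * Real.log (N / n) ≤ K * N := by
  refine ⟨Real.log 4 + 4 + 1, by positivity, fun N => ?_⟩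
  induction N with
  | zero => simp
  | succ N ih =>
    rw [Finset.sum_Ioc_succ_top (by omega)]
    have h1 : ((N + 1 : ℕ) : ℝ) / ((N + 1 : ℕ) : ℝ) = 1 := div_self (by positivity)
    rw [h1, Real.log_one, mul_zero, add_zero]
    rcases Nat.eq_zero_or_pos N with rfl | h0
    · simp; positivity
    have h0' : (0:ℝ) < N := by exact_mod_cast h0
    have e : ∑ n ∈ Finset.Ioc 0 N, (ArithmeticFunction.vonMangoldt n + 1) *
          Real.log ((N + 1 : ℕ) / n)
        = ∑ n ∈ Finset.Ioc 0 N, (ArithmeticFunction.vonMangoldt n + 1) * Real.log (N / n)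
          + Real.log ((N + 1 : ℕ) / N) * (Chebyshev.psi N + N) := by
      have : Chebyshev.psi N + N = ∑ n ∈ Finset.Ioc 0 N, (ArithmeticFunction.vonMangoldt n + 1) := by
        rw [Chebyshev.psi, Finset.sum_add_distrib]; simp
      rw [this, Finset.mul_sum, ← Finset.sum_add_distrib]
      apply Finset.sum_congr rfl
      intro n hn
      have hn0 : (0:ℝ) < n := by exact_mod_cast (Finset.mem_Ioc.1 hn).1
      rw [Real.log_div (by positivity) hn0.ne', Real.log_div (by positivity) hn0.ne',
        Real.log_div (by positivity) (by positivity)]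
      ring
    rw [e]
    have h2 : Real.log ((N + 1 : ℕ) / N) ≤ 1 / N := by
      have := Real.log_le_sub_one_of_pos (show 0 < ((N + 1 : ℕ) : ℝ) / N by positivity)
      refine this.trans (le_of_eq ?_)
      push_cast; field_simp; ring
    have h3 := Chebyshev.psi_le_const_mul_self (x := (N:ℝ)) (by positivity)
    have h4 : Real.log ((N + 1 : ℕ) / N) * (Chebyshev.psi N + N) ≤ 1 / N * ((Real.log 4 + 4) * N + N) := by
      have := Chebyshev.psi_nonneg N
      gcongr
    have h5 : 1 / N * ((Real.log 4 + 4) * N + N) = Real.log 4 + 4 + 1 := by field_simp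
    push_cast at *
    linarith

lemma psi_bound : ∃ K : ℝ, 0 < K ∧ ∀ N : ℕ, 3 ≤ N →
    |Chebyshev.psi N - N| ≤ K * (N / Real.log N) := by
  obtain ⟨K, hK, hD⟩ := D_bound
  obtain ⟨K', hK', hW⟩ := W_bound
  refine ⟨K + 2 * K', by positivity, fun N hN => ?_⟩
  have hN' : (3:ℝ) ≤ N := by exact_mod_cast hN
  have hd := hD N hN'
  have hw := hW N
  set l := Real.log N with hl
  have hl0 : 0 < l := Real.log_pos (by linarith)
  have hE : Chebyshev.psi N - N = ∑ n ∈ Finset.Ioc 0 N, (ArithmeticFunction.vonMangoldt n - 1) := by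
    rw [Chebyshev.psi, Finset.sum_sub_distrib]; simp
  have hDe : D N = ∑ n ∈ Finset.Ioc 0 N, a n := by
    unfold D
    rw [Nat.floor_natCast, Finset.sum_range_eq_add_Ico _ (by omega)]
    simp only [a, Nat.cast_zero, Real.log_zero]
    simp
    rfl
  have key : |l ^ 2 * (Chebyshev.psi N - N) - D N| ≤ 2 * l * (K' * N) := by
    rw [hE, hDe, Finset.mul_sum, ← Finset.sum_sub_distrib]
    refine (Finset.abs_sum_le_sum_abs _ _).trans ?_
    refine le_trans ?_ (mul_le_mul_of_nonneg_left hw (by positivity))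
    rw [Finset.mul_sum]
    apply Finset.sum_le_sum
    intro n hn
    have hn1 : (1:ℝ) ≤ n := by exact_mod_cast (Finset.mem_Ioc.1 hn).1
    have hn2 : (n:ℝ) ≤ N := by exact_mod_cast (Finset.mem_Ioc.1 hn).2
    have hv := ArithmeticFunction.vonMangoldt_nonneg (n := n)
    have g1 : 0 ≤ Real.log n := Real.log_nonneg hn1
    have g2 : Real.log n ≤ l := Real.log_le_log (by linarith) hn2
    have e : l ^ 2 * (ArithmeticFunction.vonMangoldt n - 1) - a n =
      (ArithmeticFunction.vonMangoldt n - 1) * ((l + Real.log n) * (l - Real.log n)) := by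
      unfold a; ring
    rw [e, abs_mul, abs_of_nonneg (mul_nonneg (by linarith) (by linarith) :
      0 ≤ (l + Real.log n) * (l - Real.log n)), Real.log_div (by linarith) (by linarith)]
    have g3 : |ArithmeticFunction.vonMangoldt n - 1| ≤ ArithmeticFunction.vonMangoldt n + 1 := by
      rw [abs_le]; constructor <;> linarith
    have g4 : 0 ≤ l - Real.log n := by linarith
    calc _ ≤ (ArithmeticFunction.vonMangoldt n + 1) * ((2 * l) * (l - Real.log n)) := by
          gcongr; linarith
      _ = _ := by ring
  have h2 : l ^ 2 * |Chebyshev.psi N - N| ≤ (K + 2 * K') * (N * l) := by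
    have : l ^ 2 * |Chebyshev.psi N - N| = |l ^ 2 * (Chebyshev.psi N - N)| := by
      rw [abs_mul, abs_of_pos (by positivity : 0 < l ^ 2)]
    rw [this]
    have := abs_sub_abs_le_abs_sub (l ^ 2 * (Chebyshev.psi N - N)) (D N)
    linarith
  have h3 : (K + 2 * K') * (N * l) = l ^ 2 * ((K + 2 * K') * (N / l)) := by field_simp
  rw [h3] at h2
  exact le_of_mul_le_mul_left h2 (by positivity)

lemma final : ∃ C : ℝ, ∀ᶠ N : ℕ in atTop,
    |(N : ℝ) / (Nat.primeCounting N : ℝ) - Real.log N| ≤ C := by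
  obtain ⟨K, hK, h1⟩ := psi_bound
  obtain ⟨C2, h2⟩ := Chebyshev.psi_sub_theta_le_mul_sqrt
  obtain ⟨C3, h3⟩ := Chebyshev.primeCounting_sub_theta_div_log_isBigO.bound
  have h3' := tendsto_natCast_atTop_atTop (R := ℝ) |>.eventually h3
  set C := K + 2 * |C2| + C3 with hC
  have ht : Tendsto (fun N : ℕ => Real.log N) atTop atTop :=
    Real.tendsto_log_atTop.comp tendsto_natCast_atTop_atTop
  refine ⟨2 * C, ?_⟩
  filter_upwards [h3', eventually_ge_atTop 3, ht.eventually_ge_atTop (2 * C)] with N h3 hN hl2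
  have hN' : (3:ℝ) ≤ N := by exact_mod_cast hN
  have h1 := h1 N hN
  have h2 := h2 N
  have h2' := Chebyshev.theta_le_psi N
  set l := Real.log N with hl
  have hl0 : 0 < l := Real.log_pos (by linarith)
  rw [Nat.floor_natCast, Real.norm_eq_abs, Real.norm_eq_abs,
    abs_of_pos (show 0 < (N:ℝ) / l ^ 2 by positivity)] at h3
  set p : ℝ := (Nat.primeCounting N : ℝ) with hp
  have hsq : √(N:ℝ) ≤ 2 * (N / l) := by
    have hs : 0 < √(N:ℝ) := Real.sqrt_pos.2 (by linarith)
    have e : l = 2 * Real.log √(N:ℝ) := by rw [Real.log_sqrt (by linarith)]; ring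
    have e2 := Real.log_le_sub_one_of_pos hs
    rw [← mul_div_assoc, le_div_iff₀ hl0]
    nlinarith [Real.mul_self_sqrt (show 0 ≤ (N:ℝ) by linarith)]
  have hth : |Chebyshev.psi N - Chebyshev.theta N| ≤ 2 * |C2| * (N / l) := by
    rw [abs_of_nonneg (by linarith)]
    calc _ ≤ C2 * √(N:ℝ) := h2
      _ ≤ |C2| * (2 * (N / l)) := by gcongr; exact le_abs_self _
      _ = _ := by ring
  have h4 : |p * l - Chebyshev.theta N| ≤ C3 * (N / l) := by
    have e : p * l - Chebyshev.theta N = (p - Chebyshev.theta N / l) * l := by field_simp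
    rw [e, abs_mul, abs_of_pos hl0]
    calc _ ≤ C3 * (N / l ^ 2) * l := by gcongr
      _ = _ := by field_simp
  have h5 : |N - p * l| ≤ C * (N / l) := by
    rw [abs_le] at *
    constructor <;> linarith [h1.1, h1.2, hth.1, hth.2, h4.1, h4.2]
  have h6 : C * (N / l) ≤ N / 2 := by
    rw [← mul_div_assoc, div_le_iff₀ hl0]; nlinarith
  have h7 : N / 2 ≤ p * l := by linarith [(abs_le.1 h5).2]
  have hp0 : 0 < p := by
    by_contra! h
    nlinarith
  have e : N / p - l = (N - p * l) / p := by field_simp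
  rw [e, abs_div, abs_of_pos hp0, div_le_iff₀ hp0]
  have hC0 : 0 ≤ C := by
    by_contra! h
    have : C * (N / l) < 0 := mul_neg_of_neg_of_pos h (by positivity)
    linarith [abs_nonneg (N - p * l)]
  refine h5.trans ?_
  rw [← mul_div_assoc, div_le_iff₀ hl0]
  nlinarith
end PNTaux

/-- There is an absolute constant `C > 0` with `|N / π(N) - log N| ≤ 6C` for all
`N ≥ 2`; in particular the sequence `(N / π(N) - log N)_{N ≥ 2}` is bounded. -/
theorem nat_div_primeCounting_sub_log_bounded :
    ∃ C : ℝ, 0 < C ∧ ∀ N : ℕ, 2 ≤ N →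
      |(N : ℝ) / (Nat.primeCounting N : ℝ) - Real.log N| ≤ 6 * C := by
  obtain ⟨C, hC⟩ := PNTaux.final
  obtain ⟨M, hM⟩ := eventually_atTop.1 hC
  set S := ∑ n ∈ Finset.range M, |(n : ℝ) / (Nat.primeCounting n : ℝ) - Real.log n| with hS
  have hS0 : 0 ≤ S := Finset.sum_nonneg fun _ _ => abs_nonneg _
  refine ⟨|C| + S + 1, by positivity, fun N _ => ?_⟩
  have hC' := le_abs_self C
  have hC0 := abs_nonneg C
  rcases lt_or_ge N M with h | h
  · have := Finset.single_le_sum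
      (f := fun n : ℕ => |(n : ℝ) / (Nat.primeCounting n : ℝ) - Real.log n|)
      (fun _ _ => abs_nonneg _) (Finset.mem_range.2 h)
    linarith
  · linarith [hM N h]
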